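/- arXiv:2006.03438 — 2 statements merged into one kernel-verified Lean document; each statement's English description precedes it below -/
import Mathlib

section
/- Let [a, b], with a, b ∈ {1, …, n−1}, be the fluctuation interval of some fluctuation set. Then the maximum at k = a over all 2m lines (active or not) is attained by a cooperative line, and the maximum at k = b over all 2m lines is attained by a defective line. -/
/-- A finite well-mixed population with `m ≥ 1` types: type `i` consists of
`nvec i ≥ 1` identical agents with real payoff entries `R i, S i, T i, P i`. -/
structure Pop (m : ℕ) where
  hm : 0 < m
  nvec : Fin m → ℕ
  hnvec : ∀ i, 1 ≤ nvec i
  R : Fin m → ℝ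
  S : Fin m → ℝ
  T : Fin m → ℝ
  P : Fin m → ℝ

variable {m : ℕ}

/-- The total number `n` of agents. -/
def nTot (pop : Pop m) : ℕ := ∑ i, pop.nvec i

/-- Cooperative line of type `i`:  `u_i^C(k) = (R_i - S_i)·k + S_i·n`. -/
noncomputable def uC (pop : Pop m) (i : Fin m) (k : ℝ) : ℝ :=
  (pop.R i - pop.S i) * k + pop.S i * (nTot pop : ℝ)

/-- Defective line of type `i`:  `u_i^D(k) = (T_i - P_i)·k + P_i·n`. -/
noncomputable def uD (pop : Pop m) (i : Fin m) (k : ℝ) : ℝ :=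
  (pop.T i - pop.P i) * k + pop.P i * (nTot pop : ℝ)

/-- A state: `x i` cooperators of type `i`, with `x i ≤ nvec i`. -/
def IsState (pop : Pop m) (x : Fin m → ℕ) : Prop := ∀ i, x i ≤ pop.nvec i

/-- The total number of cooperators at state `x`. -/
def nC (x : Fin m → ℕ) : ℕ := ∑ i, x i

/-- The cooperative line of type `i` is active at `x`. -/
def activeC (x : Fin m → ℕ) (i : Fin m) : Prop := 0 < x i

/-- The defective line of type `i` is active at `x`. -/
def activeD (pop : Pop m) (x : Fin m → ℕ) (i : Fin m) : Prop := x i < pop.nvec i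

/-- `v` bounds from above the values, at `k = nC x`, of all lines active at `x`;
the value of an active line satisfying this attains the maximum `M(x)`. -/
def ubActive (pop : Pop m) (x : Fin m → ℕ) (v : ℝ) : Prop :=
  (∀ i, activeC x i → uC pop i (nC x) ≤ v) ∧
  (∀ i, activeD pop x i → uD pop i (nC x) ≤ v)

/-- Some active cooperative line attains the maximum `M(x)` over active lines. -/
def coopMax (pop : Pop m) (x : Fin m → ℕ) : Prop :=
  ∃ i, activeC x i ∧ ubActive pop x (uC pop i (nC x))

/-- Some active defective line attains the maximum `M(x)` over active lines. -/
def defMax (pop : Pop m) (x : Fin m → ℕ) : Prop :=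
  ∃ i, activeD pop x i ∧ ubActive pop x (uD pop i (nC x))

/-- One-step successor relation of the asynchronous imitation dynamics: one agent
is activated; an activated cooperator of type `i` switches (to `x - e_i`) exactly
when no active cooperative line attains `M(x)`, an activated defector of type `i`
switches (to `x + e_i`) exactly when no active defective line attains `M(x)`;
otherwise the state is unchanged. -/
def Step (pop : Pop m) (x y : Fin m → ℕ) : Prop :=
  (∃ i, activeC x i ∧
    ((coopMax pop x ∧ y = x) ∨
     (¬ coopMax pop x ∧ y = Function.update x i (x i - 1)))) ∨
  (∃ i, activeD pop x i ∧
    ((defMax pop x ∧ y = x) ∨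
     (¬ defMax pop x ∧ y = Function.update x i (x i + 1))))

/-- A trajectory of the dynamics. -/
def Traj (pop : Pop m) (X : ℕ → Fin m → ℕ) : Prop :=
  IsState pop (X 0) ∧ ∀ t, Step pop (X t) (X (t + 1))

/-- An equilibrium state: its only one-step successor is itself. -/
def IsEquilibrium (pop : Pop m) (x : Fin m → ℕ) : Prop :=
  IsState pop x ∧ ∀ y, Step pop x y → y = x

/-- A positively invariant set of states. -/
def PosInv (pop : Pop m) (Q : Set (Fin m → ℕ)) : Prop :=
  (∀ x ∈ Q, IsState pop x) ∧ ∀ x ∈ Q, ∀ y, Step pop x y → y ∈ Q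

/-- A minimal positively invariant set: no nonempty proper subset is positively
invariant. -/
def MinPosInv (pop : Pop m) (Q : Set (Fin m → ℕ)) : Prop :=
  PosInv pop Q ∧ ∀ Q' : Set (Fin m → ℕ), Q' ⊂ Q → Q'.Nonempty → ¬ PosInv pop Q'

/-- A fluctuation set: a minimal positively invariant set with more than one state. -/
def FluctSet (pop : Pop m) (O : Set (Fin m → ℕ)) : Prop :=
  MinPosInv pop O ∧ ∃ x ∈ O, ∃ y ∈ O, x ≠ y

/-- `[a, b]` is the fluctuation interval of the fluctuation set `O`:
`a = min {nC x : x ∈ O}` and `b = max {nC x : x ∈ O}`. -/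
def FluctInterval (pop : Pop m) (O : Set (Fin m → ℕ)) (a b : ℕ) : Prop :=
  FluctSet pop O ∧
  (∃ x ∈ O, nC x = a) ∧ (∀ x ∈ O, a ≤ nC x) ∧
  (∃ x ∈ O, nC x = b) ∧ (∀ x ∈ O, nC x ≤ b)

/-- An intersection point of `u_i^C` and `u_j^D`: a value `k ∈ [1, n-1]` with
`u_i^C(k) = u_j^D(k)`. -/
def IsInterPt (pop : Pop m) (i j : Fin m) (k : ℝ) : Prop :=
  1 ≤ k ∧ k ≤ (nTot pop : ℝ) - 1 ∧ uC pop i k = uD pop j k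

/-- Potentially attracting: `u_i^C(k - 1) > u_j^D(k - 1)`. -/
def PotAttract (pop : Pop m) (i j : Fin m) (k : ℝ) : Prop :=
  uD pop j (k - 1) < uC pop i (k - 1)

/-- A fluctuation point: a non-integer potentially attracting intersection point
`p_ij` with value `k` such that there are a state `x` with `nC x = ⌊k⌋` at which
`u_i^C` is active and attains the maximum among the lines active at `x`, and a
state obtained from `x` by increasing exactly one coordinate by `1` at which
`u_j^D` is active and attains the maximum among the active lines. -/
def IsFluctPt (pop : Pop m) (i j : Fin m) (k : ℝ) : Prop :=
  IsInterPt pop i j k ∧ PotAttract pop i j k ∧ (∀ z : ℤ, (z : ℝ) ≠ k) ∧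
  ∃ x, IsState pop x ∧ ((nC x : ℤ) = ⌊k⌋) ∧
    activeC x i ∧ ubActive pop x (uC pop i (nC x)) ∧
    ∃ l, IsState pop (Function.update x l (x l + 1)) ∧
      activeD pop (Function.update x l (x l + 1)) j ∧
      ubActive pop (Function.update x l (x l + 1))
        (uD pop j (nC (Function.update x l (x l + 1))))

/-- `[lo, hi]` contains the value of a fluctuation point. -/
def HasFluctPtIn (pop : Pop m) (lo hi : ℝ) : Prop :=
  ∃ i j : Fin m, ∃ k : ℝ, IsFluctPt pop i j k ∧ lo ≤ k ∧ k ≤ hi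

/-- `[a, a+1]` is a left wall: every trajectory starting with at least `a + 1`
cooperators always has at least `a` cooperators. -/
def LeftWall (pop : Pop m) (a : ℕ) : Prop :=
  ∀ X : ℕ → Fin m → ℕ, Traj pop X → a + 1 ≤ nC (X 0) → ∀ t, a ≤ nC (X t)

/-- `[b-1, b]` is a right wall: every trajectory starting with at most `b - 1`
cooperators always has at most `b` cooperators. -/
def RightWall (pop : Pop m) (b : ℕ) : Prop :=
  ∀ X : ℕ → Fin m → ℕ, Traj pop X → nC (X 0) ≤ b - 1 → ∀ t, nC (X t) ≤ b

/-- The 1-norm distance between two states. -/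
def dist1 (x y : Fin m → ℕ) : ℕ := ∑ i, ((x i : ℤ) - (y i : ℤ)).natAbs

/-- Lyapunov stability of an equilibrium state `s`. -/
def Stable (pop : Pop m) (s : Fin m → ℕ) : Prop :=
  ∀ ε : ℕ, 2 ≤ ε → ∃ δ : ℕ, 2 ≤ δ ∧
    ∀ X : ℕ → Fin m → ℕ, Traj pop X → dist1 (X 0) s < δ → ∀ t, dist1 (X t) s < ε

theorem nC_up (x : Fin m → ℕ) (i : Fin m) :
    nC (Function.update x i (x i + 1)) = nC x + 1 := by
  unfold nC
  rw [Finset.sum_update_of_mem (Finset.mem_univ i),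
    ← Finset.add_sum_erase _ x (Finset.mem_univ i), Finset.sdiff_singleton_eq_erase]
  omega

theorem nC_down (x : Fin m → ℕ) (i : Fin m) (h : 0 < x i) :
    nC (Function.update x i (x i - 1)) + 1 = nC x := by
  unfold nC
  rw [Finset.sum_update_of_mem (Finset.mem_univ i),
    ← Finset.add_sum_erase _ x (Finset.mem_univ i), Finset.sdiff_singleton_eq_erase]
  omega

theorem exists_actC (x : Fin m → ℕ) (h : 1 ≤ nC x) : ∃ i, activeC x i := by
  by_contra hc
  push Not at hc
  have : nC x = 0 := Finset.sum_eq_zero fun i _ => by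
    have := hc i
    unfold activeC at this
    omega
  omega

theorem exists_actD (pop : Pop m) (x : Fin m → ℕ) (h : nC x < nTot pop) :
    ∃ i, activeD pop x i := by
  by_contra hc
  push Not at hc
  have : nTot pop ≤ nC x := Finset.sum_le_sum fun i _ => by
    have := hc i
    unfold activeD at this
    omega
  omega

/-- No state of a fluctuation set has both kinds of lines attaining the max. -/
theorem not_both (pop : Pop m) (O : Set (Fin m → ℕ)) (hO : FluctSet pop O)
    (x : Fin m → ℕ) (hx : x ∈ O) (hc : coopMax pop x) (hd : defMax pop x) : False := by
  obtain ⟨⟨⟨hst, hinv⟩, hmin⟩, p, hp, q, hq, hpq⟩ := hO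
  refine hmin {x} ?_ ⟨x, rfl⟩ ⟨?_, ?_⟩
  · refine (Set.ssubset_iff_subset_ne).2 ⟨by simpa using hx, ?_⟩
    rintro rfl
    exact hpq (by rw [Set.mem_singleton_iff] at hp hq; rw [hp, hq])
  · rintro y rfl
    exact hst _ hx
  · rintro y rfl z hz
    rcases hz with ⟨i, _, h | h⟩ | ⟨i, _, h | h⟩
    · exact h.2
    · exact absurd hc h.1
    · exact h.2
    · exact absurd hd h.1

/-- A level set met by `O` but not containing it is entered from outside. -/
theorem enter (pop : Pop m) (O : Set (Fin m → ℕ)) (hO : FluctSet pop O) (a : ℕ)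
    (x w : Fin m → ℕ) (hx : x ∈ O) (hxa : nC x = a) (hw : w ∈ O) (hwa : nC w ≠ a) :
    ∃ y ∈ O, nC y ≠ a ∧ ∃ z ∈ O, nC z = a ∧ Step pop y z := by
  obtain ⟨⟨⟨hst, hinv⟩, hmin⟩, -⟩ := hO
  have h := hmin {v | v ∈ O ∧ nC v ≠ a} ?_ ⟨w, hw, hwa⟩
  · by_contra hc
    push Not at hc
    refine h ⟨fun v hv => hst v hv.1, fun v hv z hz => ⟨hinv v hv.1 z hz, fun hza => ?_⟩⟩
    exact hc v hv.1 hv.2 z (hinv v hv.1 z hz) hza hz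
  · refine (Set.ssubset_iff_of_subset fun v hv => hv.1).2 ⟨x, hx, fun h => h.2 hxa⟩

theorem stepC (pop : Pop m) (O : Set (Fin m → ℕ)) (hO : FluctSet pop O)
    (x : Fin m → ℕ) (hx : x ∈ O) (hc : ¬ coopMax pop x) (i : Fin m) (hi : 0 < x i) :
    Function.update x i (x i - 1) ∈ O :=
  hO.1.1.2 x hx _ (Or.inl ⟨i, hi, Or.inr ⟨hc, rfl⟩⟩)

theorem stepD (pop : Pop m) (O : Set (Fin m → ℕ)) (hO : FluctSet pop O)
    (x : Fin m → ℕ) (hx : x ∈ O) (hc : ¬ defMax pop x) (i : Fin m) (hi : x i < pop.nvec i) :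
    Function.update x i (x i + 1) ∈ O :=
  hO.1.1.2 x hx _ (Or.inr ⟨i, hi, Or.inr ⟨hc, rfl⟩⟩)

/-- at the endpoints of a fluctuation interval, the maximum over
all `2m` lines is attained by a cooperative (resp. defective) line. -/
theorem stmt2 (pop : Pop m) (O : Set (Fin m → ℕ)) (a b : ℕ)
    (ha : 1 ≤ a) (ha' : a ≤ nTot pop - 1) (hb : 1 ≤ b) (hb' : b ≤ nTot pop - 1)
    (hO : FluctInterval pop O a b) :
    (∃ i, (∀ j, uC pop j (a : ℝ) ≤ uC pop i (a : ℝ)) ∧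
          (∀ j, uD pop j (a : ℝ) ≤ uC pop i (a : ℝ))) ∧
    (∃ i, (∀ j, uC pop j (b : ℝ) ≤ uD pop i (b : ℝ)) ∧
          (∀ j, uD pop j (b : ℝ) ≤ uD pop i (b : ℝ))) := by
  obtain ⟨hF, ⟨x, hx, hxa⟩, hmin, ⟨w, hw, hwb⟩, hmax⟩ := hO
  have hn : 1 ≤ nTot pop := by omega
  haveI : Nonempty (Fin m) := ⟨⟨0, pop.hm⟩⟩
  have key : ∀ k : ℝ, ∃ i j, (∀ l, uC pop l k ≤ uC pop i k) ∧ (∀ l, uD pop l k ≤ uD pop j k) := by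
    intro k
    obtain ⟨i, hi⟩ := Finite.exists_max (fun i => uC pop i k)
    obtain ⟨j, hj⟩ := Finite.exists_max (fun i => uD pop i k)
    exact ⟨i, j, hi, hj⟩
  constructor
  · obtain ⟨i, j, hi, hj⟩ := key a
    refine ⟨i, hi, fun l => (hj l).trans ?_⟩
    by_contra hlt
    push Not at hlt
    -- at level a every state is coopMax
    have hcoop : ∀ v ∈ O, nC v = a → coopMax pop v := by
      intro v hv hva
      by_contra hc
      obtain ⟨l, hl⟩ := exists_actC v (by omega)
      have h1 := hmin _ (stepC pop O hF v hv hc l hl)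
      have h2 := nC_down v l hl
      omega
    have hfull : ∀ v ∈ O, nC v = a → ¬ v j < pop.nvec j := by
      intro v hv hva hact
      obtain ⟨l, hl, hub⟩ := hcoop v hv hva
      have h1 := hub.2 j hact
      rw [hva] at h1
      linarith [hi l]
    have hnd : ¬ defMax pop x := fun hd => not_both pop O hF x hx (hcoop x hx hxa) hd
    obtain ⟨l, hl⟩ := exists_actD pop x (by omega)
    have hup := stepD pop O hF x hx hnd l hl
    have hupn := nC_up x l
    obtain ⟨y, hy, hya, z, hz, hza, hst⟩ := enter pop O hF a x _ hx hxa hup (by omega)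
    have hya' := hmin y hy
    have hzf := hfull z hz hza
    have hpos := pop.hnvec j
    rcases hst with ⟨r, hr, h | ⟨hnc, rfl⟩⟩ | ⟨r, hr, h | ⟨hnd', rfl⟩⟩
    · exact hya (h.2 ▸ hza)
    · have hd := nC_down y r hr
      have hyj : 0 < y j ∧ y j ≤ pop.nvec j := by
        refine ⟨?_, hF.1.1.1 y hy j⟩
        by_cases hjr : j = r
        · subst hjr; exact hr
        · rw [Function.update_of_ne hjr] at hzf; omega
      have hd2 := nC_down y j hyj.1
      refine hfull _ (stepC pop O hF y hy hnc j hyj.1) (by omega) ?_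
      rw [Function.update_self]
      omega
    · exact hya (h.2 ▸ hza)
    · have := nC_up y r
      omega
  · obtain ⟨i, j, hi, hj⟩ := key b
    refine ⟨j, fun l => (hi l).trans ?_, hj⟩
    by_contra hlt
    push Not at hlt
    have hdef : ∀ v ∈ O, nC v = b → defMax pop v := by
      intro v hv hva
      by_contra hc
      obtain ⟨l, hl⟩ := exists_actD pop v (by omega)
      have h1 := hmax _ (stepD pop O hF v hv hc l hl)
      have h2 := nC_up v l
      omega
    have hzero : ∀ v ∈ O, nC v = b → ¬ 0 < v i := by
      intro v hv hva hact
      obtain ⟨l, hl, hub⟩ := hdef v hv hva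
      have h1 := hub.1 i hact
      rw [hva] at h1
      linarith [hj l]
    have hnc : ¬ coopMax pop w := fun hc => not_both pop O hF w hw hc (hdef w hw hwb)
    obtain ⟨l, hl⟩ := exists_actC w (by omega)
    have hdn := stepC pop O hF w hw hnc l hl
    have hdnn := nC_down w l hl
    obtain ⟨y, hy, hya, z, hz, hza, hst⟩ := enter pop O hF b w _ hw hwb hdn (by omega)
    have hya' := hmax y hy
    have hzf := hzero z hz hza
    have hpos := pop.hnvec i
    rcases hst with ⟨r, hr, h | ⟨hnc', rfl⟩⟩ | ⟨r, hr, h | ⟨hnd', rfl⟩⟩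
    · exact hya (h.2 ▸ hza)
    · have := nC_down y r hr
      omega
    · exact hya (h.2 ▸ hza)
    · have hd := nC_up y r
      have hyi : y i < pop.nvec i := by
        by_cases hir : i = r
        · subst hir; exact hr
        · rw [Function.update_of_ne hir] at hzf; omega
      have hd2 := nC_up y i
      refine hzero _ (stepD pop O hF y hy hnd' i hyi) (by omega) ?_
      rw [Function.update_self]
      omega
end

section
/- Suppose m ≥ 2. The extreme equilibrium (0, …, 0) is unstable if and only if there exists a type i such that: u_i^C(1) > u_j^D(1) for every type j, in case n_i > 1; or u_i^C(1) > u_j^D(1) for every type j ≠ i, in case n_i = 1. Likewise, the extreme equilibrium (n_1, …, n_m) is unstable if and only if there exists a type i such that: u_i^D(n−1) > u_j^C(n−1) for every type j, in case n_i > 1; or u_i^D(n−1) > u_j^C(n−1) for every type j ≠ i, in case n_i = 1. -/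
variable {m : ℕ}

theorem step_state (pop : Pop m) {x y : Fin m → ℕ} (hx : IsState pop x) (h : Step pop x y) :
    IsState pop y := by
  rcases h with ⟨i, hi, ⟨_, rfl⟩ | ⟨_, rfl⟩⟩ | ⟨i, hi, ⟨_, rfl⟩ | ⟨_, rfl⟩⟩
  · exact hx
  · intro j
    have := hx j
    by_cases hj : j = i
    · subst hj; simp; omega
    · simpa [hj] using this
  · exact hx
  · intro j
    have := hx j
    by_cases hj : j = i
    · subst hj; unfold activeD at hi; simp; omega
    · simpa [hj] using this

theorem step_total (pop : Pop m) (x : Fin m → ℕ) : ∃ y, Step pop x y := by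
  let i : Fin m := ⟨0, pop.hm⟩
  have hi := pop.hnvec i
  by_cases h : 0 < x i
  · by_cases hc : coopMax pop x
    · exact ⟨x, Or.inl ⟨i, h, Or.inl ⟨hc, rfl⟩⟩⟩
    · exact ⟨_, Or.inl ⟨i, h, Or.inr ⟨hc, rfl⟩⟩⟩
  · have h' : activeD pop x i := by unfold activeD; omega
    by_cases hc : defMax pop x
    · exact ⟨x, Or.inr ⟨i, h', Or.inl ⟨hc, rfl⟩⟩⟩
    · exact ⟨_, Or.inr ⟨i, h', Or.inr ⟨hc, rfl⟩⟩⟩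

theorem unstable_iff (pop : Pop m) (s : Fin m → ℕ) :
    ¬ Stable pop s ↔
      ∃ x y, IsState pop x ∧ dist1 x s < 2 ∧ Step pop x y ∧ 2 ≤ dist1 y s := by
  constructor
  · intro h
    by_contra hc
    push Not at hc
    apply h
    intro ε hε
    refine ⟨2, le_refl _, ?_⟩
    intro X hX h0 t
    have key : ∀ t, IsState pop (X t) ∧ dist1 (X t) s < 2 := by
      intro t
      induction t with
      | zero => exact ⟨hX.1, h0⟩
      | succ t ih => exact ⟨step_state pop ih.1 (hX.2 t), hc _ _ ih.1 ih.2 (hX.2 t)⟩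
    have := (key t).2
    omega
  · rintro ⟨x, y, hx, hd, hs, hy⟩ hst
    obtain ⟨δ, hδ, H⟩ := hst 2 (le_refl _)
    choose f hf using step_total pop
    let X : ℕ → Fin m → ℕ := fun t => match t with
      | 0 => x
      | t + 1 => f^[t] y
    have hT : Traj pop X := by
      refine ⟨hx, ?_⟩
      intro t
      cases t with
      | zero => exact hs
      | succ t =>
        change Step pop (f^[t] y) (f^[t+1] y)
        rw [Function.iterate_succ_apply']
        exact hf _
    have := H X hT (by change dist1 x s < δ; omega) 1
    change dist1 y s < 2 at this
    omega

theorem not_defMax (pop : Pop m) (x : Fin m → ℕ) (h : ∃ j, activeD pop x j) :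
    ¬ defMax pop x ↔ ∃ i, activeC x i ∧ ∀ j, activeD pop x j →
      uD pop j (nC x) < uC pop i (nC x) := by
  constructor
  · intro hd
    by_contra hc
    push Not at hc
    apply hd
    obtain ⟨j, hj, hmax⟩ := Set.exists_max_image {j | activeD pop x j}
      (fun j => uD pop j (nC x)) (Set.toFinite _) h
    refine ⟨j, hj, ?_, fun k hk => hmax k hk⟩
    intro i hi
    obtain ⟨k, hk, hle⟩ := hc i hi
    exact hle.trans (hmax k hk)
  · rintro ⟨i, hi, hlt⟩ ⟨j, hj, hub⟩
    exact absurd (hub.1 i hi) (not_le.mpr (hlt j hj))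

theorem not_coopMax (pop : Pop m) (x : Fin m → ℕ) (h : ∃ j, activeC x j) :
    ¬ coopMax pop x ↔ ∃ i, activeD pop x i ∧ ∀ j, activeC x j →
      uC pop j (nC x) < uD pop i (nC x) := by
  constructor
  · intro hd
    by_contra hc
    push Not at hc
    apply hd
    obtain ⟨j, hj, hmax⟩ := Set.exists_max_image {j | activeC x j}
      (fun j => uC pop j (nC x)) (Set.toFinite _) h
    refine ⟨j, hj, fun k hk => hmax k hk, ?_⟩
    intro i hi
    obtain ⟨k, hk, hle⟩ := hc i hi
    exact hle.trans (hmax k hk)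
  · rintro ⟨i, hi, hlt⟩ ⟨j, hj, hub⟩
    exact absurd (hub.2 i hi) (not_le.mpr (hlt j hj))

theorem nC_update (x : Fin m → ℕ) (i : Fin m) (a : ℕ) :
    nC (Function.update x i a) + x i = nC x + a := by
  unfold nC
  rw [Finset.sum_update_of_mem (Finset.mem_univ i),
    ← Finset.add_sum_erase Finset.univ x (Finset.mem_univ i), Finset.sdiff_singleton_eq_erase]
  omega

theorem dist1_zero (x : Fin m → ℕ) : dist1 x (fun _ => 0) = nC x := by
  simp [dist1, nC]

theorem dist1_top (pop : Pop m) (x : Fin m → ℕ) (hx : IsState pop x) :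
    dist1 x pop.nvec + nC x = nTot pop := by
  unfold dist1 nC nTot
  rw [← Finset.sum_add_distrib]
  apply Finset.sum_congr rfl
  intro i _
  have := hx i
  omega

theorem eq_single (x : Fin m → ℕ) (h : nC x = 1) : ∃ i, ∀ j, x j = if j = i then 1 else 0 := by
  have : ∃ i, x i ≠ 0 := by
    by_contra hc
    push Not at hc
    simp [nC, hc] at h
  obtain ⟨i, hi⟩ := this
  refine ⟨i, ?_⟩
  have h2 := Finset.add_sum_erase Finset.univ x (Finset.mem_univ i)
  unfold nC at h
  have h3 : ∑ k ∈ Finset.univ.erase i, x k = 0 := by omega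
  intro j
  split_ifs with hj
  · subst hj; omega
  · exact Finset.sum_eq_zero_iff.mp h3 j (by simp [hj])

theorem part1 (pop : Pop m) (hm : 2 ≤ m) :
    (¬ Stable pop (fun _ => 0) ↔
      ∃ i : Fin m,
        (1 < pop.nvec i → ∀ j, uD pop j 1 < uC pop i 1) ∧
        (pop.nvec i = 1 → ∀ j, j ≠ i → uD pop j 1 < uC pop i 1)) := by
  rw [unstable_iff]
  constructor
  · rintro ⟨x, y, hx, hd, hs, hy⟩
    rw [dist1_zero] at hd hy
    rcases hs with ⟨i, hi, ⟨_, rfl⟩ | ⟨_, rfl⟩⟩ | ⟨i, hi, ⟨_, rfl⟩ | ⟨hn, rfl⟩⟩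
    · omega
    · have := nC_update x i (x i - 1); omega
    · omega
    · have := nC_update x i (x i + 1)
      have h1 : nC x = 1 := by omega
      obtain ⟨k, hk⟩ := eq_single x h1
      obtain ⟨l, hl, hlt⟩ := (not_defMax pop x ⟨i, hi⟩).mp hn
      have hlk : l = k := by
        by_contra hne
        simp [activeC, hk, hne] at hl
      subst hlk
      rw [h1, Nat.cast_one] at hlt
      refine ⟨l, ?_, ?_⟩
      · intro hgt j
        apply hlt
        unfold activeD
        rw [hk]
        have := pop.hnvec j
        split_ifs with hj
        · subst hj; exact hgt
        · omega
      · intro _ j hj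
        apply hlt
        unfold activeD
        rw [hk, if_neg hj]
        have := pop.hnvec j
        omega
  · rintro ⟨i, hA, hB⟩
    let x : Fin m → ℕ := fun j => if j = i then 1 else 0
    have h1 : nC x = 1 := by simp [nC, x]
    have : Nontrivial (Fin m) := Fin.nontrivial_iff_two_le.mpr hm
    obtain ⟨l, hl⟩ := exists_ne i
    have hal : activeD pop x l := by
      simpa [activeD, x, hl, Nat.pos_iff_ne_zero, Nat.one_le_iff_ne_zero] using pop.hnvec l
    refine ⟨x, Function.update x l (x l + 1), ?_, ?_, Or.inr ⟨l, hal, Or.inr ⟨?_, rfl⟩⟩, ?_⟩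
    · intro j
      have := pop.hnvec j
      simp only [x]; split_ifs <;> omega
    · rw [dist1_zero]; omega
    · rw [not_defMax pop x ⟨l, hal⟩]
      refine ⟨i, by simp [activeC, x], ?_⟩
      rw [h1, Nat.cast_one]
      intro j hj
      rcases (pop.hnvec i).lt_or_eq with h | h
      · exact hA h j
      · apply hB h.symm
        rintro rfl
        simp [activeD, x] at hj
        omega
    · rw [dist1_zero]
      have := nC_update x l (x l + 1)
      omega

theorem part2 (pop : Pop m) (hm : 2 ≤ m) :
    (¬ Stable pop pop.nvec ↔
      ∃ i : Fin m,
        (1 < pop.nvec i →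
          ∀ j, uC pop j ((nTot pop : ℝ) - 1) < uD pop i ((nTot pop : ℝ) - 1)) ∧
        (pop.nvec i = 1 →
          ∀ j, j ≠ i →
            uC pop j ((nTot pop : ℝ) - 1) < uD pop i ((nTot pop : ℝ) - 1))) := by
  rw [unstable_iff]
  constructor
  · rintro ⟨x, y, hx, hd, hs, hy⟩
    have hdx := dist1_top pop x hx
    have hdy := dist1_top pop y (step_state pop hx hs)
    rcases hs with ⟨i, hi, ⟨_, rfl⟩ | ⟨hn, rfl⟩⟩ | ⟨i, hi, ⟨_, rfl⟩ | ⟨_, rfl⟩⟩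
    · omega
    · have := nC_update x i (x i - 1)
      have h1 : nC x + 1 = nTot pop := by unfold activeC at hi; omega
      have h1' : nC (fun j => pop.nvec j - x j) = 1 := by
        have : nC (fun j => pop.nvec j - x j) + nC x = nTot pop := by
          unfold nC nTot
          rw [← Finset.sum_add_distrib]
          exact Finset.sum_congr rfl fun j _ => Nat.sub_add_cancel (hx j)
        omega
      obtain ⟨k, hk⟩ := eq_single _ h1'
      obtain ⟨l, hl, hlt⟩ := (not_coopMax pop x ⟨i, hi⟩).mp hn
      have hlk : l = k := by
        by_contra hne
        have := hk l
        rw [if_neg hne] at this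
        unfold activeD at hl
        omega
      subst hlk
      have hc : (nC x : ℝ) = (nTot pop : ℝ) - 1 := by rw [← h1]; push_cast; ring
      rw [hc] at hlt
      refine ⟨l, ?_, ?_⟩
      · intro hgt j
        apply hlt
        unfold activeC
        have h2 := hk j
        have := pop.hnvec j
        split_ifs at h2 with hj
        · subst hj; omega
        · omega
      · intro _ j hj
        apply hlt
        unfold activeC
        have h2 := hk j
        rw [if_neg hj] at h2
        have := pop.hnvec j
        omega
    · omega
    · have := nC_update x i (x i + 1); omega
  · rintro ⟨i, hA, hB⟩
    let x : Fin m → ℕ := Function.update pop.nvec i (pop.nvec i - 1)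
    have hni := pop.hnvec i
    have h1 : nC x + 1 = nTot pop := by
      have := nC_update pop.nvec i (pop.nvec i - 1)
      change nC x + _ = nTot pop + _ at this
      omega
    have hc : (nC x : ℝ) = (nTot pop : ℝ) - 1 := by rw [← h1]; push_cast; ring
    have : Nontrivial (Fin m) := Fin.nontrivial_iff_two_le.mpr hm
    obtain ⟨l, hl⟩ := exists_ne i
    have hxl : x l = pop.nvec l := by simp [x, hl]
    have hxi : x i = pop.nvec i - 1 := by simp [x]
    have hal : activeC x l := by
      unfold activeC; rw [hxl]; exact pop.hnvec l
    have hx : IsState pop x := by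
      intro j
      by_cases hj : j = i
      · subst hj; omega
      · simp [x, hj]
    have hs : Step pop x (Function.update x l (x l - 1)) := by
      refine Or.inl ⟨l, hal, Or.inr ⟨?_, rfl⟩⟩
      rw [not_coopMax pop x ⟨l, hal⟩]
      refine ⟨i, by unfold activeD; omega, ?_⟩
      rw [hc]
      intro j hj
      rcases (pop.hnvec i).lt_or_eq with h | h
      · exact hA h j
      · apply hB h.symm
        rintro rfl
        unfold activeC at hj
        omega
    have hdx := dist1_top pop x hx
    have hdy := dist1_top pop _ (step_state pop hx hs)
    refine ⟨x, _, hx, by omega, hs, ?_⟩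
    have := nC_update x l (x l - 1)
    unfold activeC at hal
    omega

/-- instability of the two extreme equilibria in a population with
at least two types. -/
theorem stmt12 (pop : Pop m) (hm : 2 ≤ m) :
    (¬ Stable pop (fun _ => 0) ↔
      ∃ i : Fin m,
        (1 < pop.nvec i → ∀ j, uD pop j 1 < uC pop i 1) ∧
        (pop.nvec i = 1 → ∀ j, j ≠ i → uD pop j 1 < uC pop i 1)) ∧
    (¬ Stable pop pop.nvec ↔
      ∃ i : Fin m,
        (1 < pop.nvec i →
          ∀ j, uC pop j ((nTot pop : ℝ) - 1) < uD pop i ((nTot pop : ℝ) - 1)) ∧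
        (pop.nvec i = 1 →
          ∀ j, j ≠ i →
            uC pop j ((nTot pop : ℝ) - 1) < uD pop i ((nTot pop : ℝ) - 1))) := by
  exact ⟨part1 pop hm, part2 pop hm⟩
end
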